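/- Let Π be the set of all stationary policies. Then any pair of reward functions R₁, R₂ that are unhackable on Π and both non-trivial on Π are equivalent on Π. -/

import Mathlib

open scoped BigOperators

/-- A rewardless MDP with finite state and action spaces: transition kernel `T`,
initial distribution `I`, and discount factor `γ ∈ (0,1)`. -/
structure MDPnr (S A : Type) [Fintype S] [Fintype A] where
  T : S → A → S → ℝ
  T_nonneg : ∀ s a s', 0 ≤ T s a s'
  T_sum : ∀ s a, ∑ s', T s a s' = 1
  I : S → ℝ
  I_nonneg : ∀ s, 0 ≤ I s
  I_sum : ∑ s, I s = 1
  γ : ℝ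
  γ_pos : 0 < γ
  γ_lt_one : γ < 1

variable {S A : Type} [Fintype S] [Fintype A]

/-- A stationary policy: a distribution over actions in each state. -/
def IsPolicy (π : S → A → ℝ) : Prop :=
  (∀ s a, 0 ≤ π s a) ∧ ∀ s, ∑ a, π s a = 1

/-- The set of all stationary policies. -/
def allPolicies (S A : Type) [Fintype S] [Fintype A] : Set (S → A → ℝ) :=
  {π | IsPolicy π}

/-- The distribution over states at time `t` induced by policy `π`. -/
def stateDist (M : MDPnr S A) (π : S → A → ℝ) : ℕ → S → ℝ
  | 0 => M.I
  | t + 1 => fun s' => ∑ s, ∑ a, stateDist M π t s * π s a * M.T s a s'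

/-- Discounted state-action visit counts `F(π)(s,a) = ∑ₜ γᵗ P(Sₜ = s, Aₜ = a)`. -/
noncomputable def visit (M : MDPnr S A) (π : S → A → ℝ) : S → A → ℝ :=
  fun s a => ∑' t : ℕ, M.γ ^ t * stateDist M π t s * π s a

/-- The visit counts viewed as a vector in `ℝ^{S×A}`. -/
noncomputable def Fvec (M : MDPnr S A) (π : S → A → ℝ) : S × A → ℝ :=
  fun p => visit M π p.1 p.2

/-- The value `J_R(π) = ∑_{s,a} R(s,a) F(π)(s,a)` of a policy `π` under reward `R`. -/
noncomputable def Jval (M : MDPnr S A) (R : S → A → ℝ) (π : S → A → ℝ) : ℝ :=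
  ∑ s, ∑ a, R s a * visit M π s a

/-- `R₁, R₂` are unhackable on policy set `P` if no pair of policies is ordered
oppositely by the two reward functions. -/
def Unhackable (M : MDPnr S A) (P : Set (S → A → ℝ)) (R₁ R₂ : S → A → ℝ) : Prop :=
  ¬ ∃ π ∈ P, ∃ π' ∈ P, Jval M R₁ π < Jval M R₁ π' ∧ Jval M R₂ π > Jval M R₂ π'

/-- `R₁, R₂` are equivalent on `P` if they induce the same preference ordering. -/
def EquivalentOn (M : MDPnr S A) (P : Set (S → A → ℝ)) (R₁ R₂ : S → A → ℝ) : Prop :=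
  ∀ π ∈ P, ∀ π' ∈ P, (Jval M R₁ π ≤ Jval M R₁ π' ↔ Jval M R₂ π ≤ Jval M R₂ π')

/-- `R` is trivial on `P` if its value function is constant on `P`. -/
def TrivialOn (M : MDPnr S A) (P : Set (S → A → ℝ)) (R : S → A → ℝ) : Prop :=
  ∀ π ∈ P, ∀ π' ∈ P, Jval M R π = Jval M R π'

/-- The embedding `G(π)(s,a) = π(a|s)` of policies into `ℝ^{S×A}`. -/
def Gmap (π : S → A → ℝ) : S × A → ℝ := fun p => π p.1 p.2

/-- A set of stationary policies is open if its image under `G` is open in the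
smallest affine subspace of `ℝ^{S×A}` containing the `G`-image of all policies. -/
def OpenPolicySet (Pd : Set (S → A → ℝ)) : Prop :=
  Pd ⊆ allPolicies S A ∧
  IsOpen {x : (affineSpan ℝ (Gmap '' allPolicies S A) : Set (S × A → ℝ)) |
    (x : S × A → ℝ) ∈ Gmap '' Pd}

/-- Every state is reachable (with positive probability) under some policy. -/
def AllReachable (M : MDPnr S A) : Prop :=
  ∀ s : S, ∃ π : S → A → ℝ, IsPolicy π ∧ ∃ t : ℕ, 0 < stateDist M π t s

/-- `R₂` is a simplification of `R₁` relative to `P`. -/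
def Simplification (M : MDPnr S A) (P : Set (S → A → ℝ)) (R₁ R₂ : S → A → ℝ) : Prop :=
  (∀ π ∈ P, ∀ π' ∈ P,
    (Jval M R₁ π < Jval M R₁ π' → Jval M R₂ π ≤ Jval M R₂ π') ∧
    (Jval M R₁ π = Jval M R₁ π' → Jval M R₂ π = Jval M R₂ π')) ∧
  ∃ π ∈ P, ∃ π' ∈ P, Jval M R₂ π = Jval M R₂ π' ∧ Jval M R₁ π ≠ Jval M R₁ π'

lemma stateDist_nonneg (M : MDPnr S A) {π : S → A → ℝ} (hπ : IsPolicy π) (t : ℕ) (s : S) :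
    0 ≤ stateDist M π t s := by
  induction t generalizing s with
  | zero => exact M.I_nonneg s
  | succ t ih =>
    exact Finset.sum_nonneg fun x _ => Finset.sum_nonneg fun a _ =>
      mul_nonneg (mul_nonneg (ih x) (hπ.1 x a)) (M.T_nonneg x a s)

/-- Pushing a vector through the transition kernel of a policy preserves its total mass. -/
lemma sum_transition (M : MDPnr S A) {π : S → A → ℝ} (hπ : IsPolicy π) (d : S → ℝ) :
    ∑ s', ∑ s, ∑ a, d s * π s a * M.T s a s' = ∑ s, d s := by
  rw [Finset.sum_comm]
  refine Finset.sum_congr rfl fun s _ => ?_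
  rw [Finset.sum_comm]
  simp_rw [← Finset.mul_sum, M.T_sum, mul_one, ← Finset.mul_sum, hπ.2, mul_one]

lemma sum_stateDist (M : MDPnr S A) {π : S → A → ℝ} (hπ : IsPolicy π) (t : ℕ) :
    ∑ s, stateDist M π t s = 1 := by
  induction t with
  | zero => exact M.I_sum
  | succ t ih => exact (sum_transition M hπ (stateDist M π t)).trans ih

lemma stateDist_le_one (M : MDPnr S A) {π : S → A → ℝ} (hπ : IsPolicy π) (t : ℕ) (s : S) :
    stateDist M π t s ≤ 1 := by
  rw [← sum_stateDist M hπ t]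
  exact Finset.single_le_sum (fun x _ => stateDist_nonneg M hπ t x) (Finset.mem_univ s)

lemma summable_discounted_stateDist (M : MDPnr S A) {π : S → A → ℝ} (hπ : IsPolicy π) (s : S) :
    Summable fun t : ℕ => M.γ ^ t * stateDist M π t s :=
  (summable_geometric_of_lt_one M.γ_pos.le M.γ_lt_one).of_nonneg_of_le
    (fun t => mul_nonneg (pow_nonneg M.γ_pos.le t) (stateDist_nonneg M hπ t s))
    (fun t => mul_le_of_le_one_right (pow_nonneg M.γ_pos.le t) (stateDist_le_one M hπ t s))

/-- Discounted state visit counts. -/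
noncomputable def stateVisit (M : MDPnr S A) (π : S → A → ℝ) (s : S) : ℝ :=
  ∑' t : ℕ, M.γ ^ t * stateDist M π t s

lemma visit_eq_stateVisit_mul (M : MDPnr S A) (π : S → A → ℝ) (s : S) (a : A) :
    visit M π s a = stateVisit M π s * π s a :=
  tsum_mul_right

lemma stateVisit_nonneg (M : MDPnr S A) {π : S → A → ℝ} (hπ : IsPolicy π) (s : S) :
    0 ≤ stateVisit M π s :=
  tsum_nonneg fun t => mul_nonneg (pow_nonneg M.γ_pos.le t) (stateDist_nonneg M hπ t s)

/-- The Bellman flow equation for discounted state visit counts. -/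
lemma stateVisit_flow (M : MDPnr S A) {π : S → A → ℝ} (hπ : IsPolicy π) (s' : S) :
    stateVisit M π s' =
      M.I s' + M.γ * ∑ s, ∑ a, stateVisit M π s * π s a * M.T s a s' := by
  have key : HasSum (fun t : ℕ => M.γ ^ (t + 1) * stateDist M π (t + 1) s')
      (M.γ * ∑ s, ∑ a, stateVisit M π s * π s a * M.T s a s') := by
    have h := (hasSum_sum fun s (_ : s ∈ Finset.univ) => hasSum_sum
      fun a (_ : a ∈ Finset.univ) => (((summable_discounted_stateDist M hπ s).hasSum.mul_right
        (π s a)).mul_right (M.T s a s'))).mul_left M.γ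
    have hfun : (fun t : ℕ => M.γ ^ (t + 1) * stateDist M π (t + 1) s') = fun t =>
        M.γ * ∑ s, ∑ a, M.γ ^ t * stateDist M π t s * π s a * M.T s a s' := by
      funext t
      simp only [stateDist, Finset.mul_sum]
      refine Finset.sum_congr rfl fun s _ => Finset.sum_congr rfl fun a _ => ?_
      ring
    rw [hfun]
    exact h
  rw [stateVisit, (summable_discounted_stateDist M hπ s').tsum_eq_zero_add, key.tsum_eq]
  simp [stateDist]

/-- The Bellman flow equation has at most one solution. -/
lemma flow_unique (M : MDPnr S A) {π : S → A → ℝ} (hπ : IsPolicy π) {d e : S → ℝ}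
    (hd : ∀ s', d s' = M.I s' + M.γ * ∑ s, ∑ a, d s * π s a * M.T s a s')
    (he : ∀ s', e s' = M.I s' + M.γ * ∑ s, ∑ a, e s * π s a * M.T s a s') : d = e := by
  have hdiff : ∀ s', |d s' - e s'| ≤ M.γ * ∑ s, ∑ a, |d s - e s| * π s a * M.T s a s' := by
    intro s'
    have h : d s' - e s' = M.γ * ∑ s, ∑ a, (d s - e s) * π s a * M.T s a s' := by
      simp_rw [sub_mul, Finset.sum_sub_distrib]
      linarith [hd s', he s']
    rw [h, abs_mul, abs_of_pos M.γ_pos]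
    refine mul_le_mul_of_nonneg_left ?_ M.γ_pos.le
    refine (Finset.abs_sum_le_sum_abs _ _).trans (Finset.sum_le_sum fun s _ => ?_)
    refine (Finset.abs_sum_le_sum_abs _ _).trans (Finset.sum_le_sum fun a _ => ?_)
    rw [abs_mul, abs_mul, abs_of_nonneg (hπ.1 s a), abs_of_nonneg (M.T_nonneg s a s')]
  have hsum : ∑ s, |d s - e s| ≤ M.γ * ∑ s, |d s - e s| := by
    refine (Finset.sum_le_sum fun s' _ => hdiff s').trans ?_
    rw [← Finset.mul_sum, sum_transition M hπ fun s => |d s - e s|]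
  have hnonneg : 0 ≤ ∑ s, |d s - e s| := Finset.sum_nonneg fun s _ => abs_nonneg _
  have hzero : ∑ s, |d s - e s| = 0 := by nlinarith [M.γ_lt_one]
  funext s
  have hs := (Finset.sum_eq_zero_iff_of_nonneg fun s _ => abs_nonneg (d s - e s)).1 hzero s
    (Finset.mem_univ s)
  exact sub_eq_zero.1 (abs_eq_zero.1 hs)

/-- The set of visit counts of stationary policies is convex. -/
lemma exists_visit_eq_mix (M : MDPnr S A) {π π' : S → A → ℝ} (hπ : IsPolicy π)
    (hπ' : IsPolicy π') {p q : ℝ} (hp : 0 ≤ p) (hq : 0 ≤ q) (hpq : p + q = 1) :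
    ∃ ρ, IsPolicy ρ ∧ ∀ s a, visit M ρ s a = p * visit M π s a + q * visit M π' s a := by
  classical
  set d : S → ℝ := fun s => p * stateVisit M π s + q * stateVisit M π' s with hd
  set v : S → A → ℝ := fun s a => p * visit M π s a + q * visit M π' s a with hv
  have hterm : ∀ s, 0 ≤ p * stateVisit M π s ∧ 0 ≤ q * stateVisit M π' s := fun s =>
    ⟨mul_nonneg hp (stateVisit_nonneg M hπ s), mul_nonneg hq (stateVisit_nonneg M hπ' s)⟩
  have hd0 : ∀ s, 0 ≤ d s := fun s => add_nonneg (hterm s).1 (hterm s).2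
  have hv' : ∀ s a, v s a = p * stateVisit M π s * π s a + q * stateVisit M π' s * π' s a := by
    intro s a
    simp only [hv, visit_eq_stateVisit_mul]
    ring
  have hv0 : ∀ s a, 0 ≤ v s a := fun s a => by
    rw [hv']
    exact add_nonneg (mul_nonneg (hterm s).1 (hπ.1 s a)) (mul_nonneg (hterm s).2 (hπ'.1 s a))
  have hvsum : ∀ s, ∑ a, v s a = d s := fun s => by
    simp_rw [hv', Finset.sum_add_distrib, ← Finset.mul_sum, hπ.2, hπ'.2, mul_one, hd]
  set ρ : S → A → ℝ := fun s a => if d s = 0 then π s a else v s a / d s with hρdef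
  have hρ : IsPolicy ρ := by
    refine ⟨fun s a => ?_, fun s => ?_⟩
    · simp only [hρdef]
      split_ifs
      · exact hπ.1 s a
      · exact div_nonneg (hv0 s a) (hd0 s)
    · simp only [hρdef]
      split_ifs with h
      · exact hπ.2 s
      · rw [← Finset.sum_div, hvsum, div_self h]
  have hdρ : ∀ s a, d s * ρ s a = v s a := by
    intro s a
    simp only [hρdef]
    split_ifs with h
    · have h0 := (Finset.sum_eq_zero_iff_of_nonneg fun a _ => hv0 s a).1 ((hvsum s).trans h) a
        (Finset.mem_univ a)
      rw [h, h0, zero_mul]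
    · exact mul_div_cancel₀ _ h
  have hflow : ∀ s', d s' = M.I s' + M.γ * ∑ s, ∑ a, d s * ρ s a * M.T s a s' := by
    intro s'
    have h : ∑ s, ∑ a, d s * ρ s a * M.T s a s' =
        p * ∑ s, ∑ a, stateVisit M π s * π s a * M.T s a s' +
          q * ∑ s, ∑ a, stateVisit M π' s * π' s a * M.T s a s' := by
      simp_rw [Finset.mul_sum, ← Finset.sum_add_distrib]
      refine Finset.sum_congr rfl fun s _ => Finset.sum_congr rfl fun a _ => ?_
      rw [hdρ, hv']
      ring
    rw [h]
    simp only [hd]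
    linear_combination p * stateVisit_flow M hπ s' + q * stateVisit_flow M hπ' s' + M.I s' * hpq
  have hdeq : d = stateVisit M ρ := flow_unique M hρ hflow (stateVisit_flow M hρ)
  refine ⟨ρ, hρ, fun s a => ?_⟩
  rw [visit_eq_stateVisit_mul, ← hdeq, hdρ]

lemma exists_Jval_eq_mix (M : MDPnr S A) {π π' : S → A → ℝ} (hπ : IsPolicy π)
    (hπ' : IsPolicy π') {p q : ℝ} (hp : 0 ≤ p) (hq : 0 ≤ q) (hpq : p + q = 1) :
    ∃ ρ, IsPolicy ρ ∧ ∀ R, Jval M R ρ = p * Jval M R π + q * Jval M R π' := by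
  obtain ⟨ρ, hρ, h⟩ := exists_visit_eq_mix M hπ hπ' hp hq hpq
  refine ⟨ρ, hρ, fun R => ?_⟩
  simp_rw [Jval, h, Finset.mul_sum, ← Finset.sum_add_distrib]
  refine Finset.sum_congr rfl fun s _ => Finset.sum_congr rfl fun a _ => ?_
  ring

lemma exists_small_mix_pos {u : ℝ} (hu : 0 < u) (w : ℝ) :
    ∃ q : ℝ, 0 < q ∧ q < 1 ∧ 0 < (1 - q) * u + q * w := by
  have hpos : 0 < u + |w| := by positivity
  refine ⟨u / (2 * (u + |w|)), by positivity, ?_, ?_⟩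
  · rw [div_lt_one (by positivity)]
    linarith [abs_nonneg w]
  · have h : (1 - u / (2 * (u + |w|))) * u + u / (2 * (u + |w|)) * w =
        u * (u + 2 * |w| + w) / (2 * (u + |w|)) := by
      field_simp
      ring
    rw [h]
    have hw : 0 < u + 2 * |w| + w := by linarith [neg_abs_le w, abs_nonneg w]
    positivity

lemma Unhackable.symm {M : MDPnr S A} {P : Set (S → A → ℝ)} {R₁ R₂ : S → A → ℝ}
    (h : Unhackable M P R₁ R₂) : Unhackable M P R₂ R₁ := by
  rintro ⟨π, hπ, π', hπ', hlt, hgt⟩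
  exact h ⟨π', hπ', π, hπ, hgt, hlt⟩

/-- Weak preference under a non-trivial reward carries over to any reward unhackable with it. -/
lemma Unhackable.le_of_le {M : MDPnr S A} {R₁ R₂ : S → A → ℝ}
    (hunh : Unhackable M (allPolicies S A) R₁ R₂) (h1 : ¬ TrivialOn M (allPolicies S A) R₁)
    {π π' : S → A → ℝ} (hπ : IsPolicy π) (hπ' : IsPolicy π')
    (hle : Jval M R₁ π ≤ Jval M R₁ π') : Jval M R₂ π ≤ Jval M R₂ π' := by
  by_contra! hlt
  have heq : Jval M R₁ π = Jval M R₁ π' :=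
    hle.eq_of_not_lt fun h => hunh ⟨π, hπ, π', hπ', h, hlt⟩
  have hz : ∃ ζ, IsPolicy ζ ∧ Jval M R₁ ζ ≠ Jval M R₁ π := by
    by_contra! hall
    exact h1 fun x hx y hy => (hall x hx).trans (hall y hy).symm
  obtain ⟨ζ, hζ, hne⟩ := hz
  rcases hne.lt_or_gt with hζlt | hζgt
  · obtain ⟨q, hq0, hq1, hq⟩ := exists_small_mix_pos (sub_pos.2 hlt) (Jval M R₂ ζ - Jval M R₂ π')
    obtain ⟨ρ, hρ, hJ⟩ := exists_Jval_eq_mix M hπ hζ (sub_nonneg.2 hq1.le) hq0.le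
      (sub_add_cancel 1 q)
    refine hunh ⟨ρ, hρ, π', hπ', ?_, ?_⟩
    · rw [hJ]
      nlinarith
    · rw [hJ]
      linarith
  · obtain ⟨q, hq0, hq1, hq⟩ := exists_small_mix_pos (sub_pos.2 hlt) (Jval M R₂ π - Jval M R₂ ζ)
    obtain ⟨ρ, hρ, hJ⟩ := exists_Jval_eq_mix M hπ' hζ (sub_nonneg.2 hq1.le) hq0.le
      (sub_add_cancel 1 q)
    refine hunh ⟨π, hπ, ρ, hρ, ?_, ?_⟩
    · rw [hJ]
      nlinarith
    · rw [hJ]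
      linarith

/-- On the set of all stationary policies, any pair of unhackable,
non-trivial reward functions are equivalent. -/
theorem unhackable_nontrivial_equivalent_on_allPolicies
    (M : MDPnr S A) (hA : 1 < Fintype.card A) (hreach : AllReachable M)
    (R₁ R₂ : S → A → ℝ)
    (hunh : Unhackable M (allPolicies S A) R₁ R₂)
    (h1 : ¬ TrivialOn M (allPolicies S A) R₁)
    (h2 : ¬ TrivialOn M (allPolicies S A) R₂) :
    EquivalentOn M (allPolicies S A) R₁ R₂ := by
  exact fun π hπ π' hπ' => ⟨hunh.le_of_le h1 hπ hπ', hunh.symm.le_of_le h2 hπ hπ'⟩
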